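/- Let V be a type, I : ℕ, and let A : ℕ → (V → V → Prop), S : ℕ → Set V, l : ℕ → V satisfy, for every i < I: l i ∉ S i, S i is independent in A i, and A (i+1) = merge(A i, S i, l i). Let Q : V → V be the composition Q = q(S (I-1), l (I-1)) ∘ ⋯ ∘ q(S 0, l 0). Then directed reachability is preserved: for all u v : V, if Relation.TransGen (A 0) u v (there is a nonempty directed walk from u to v in G_0), then Relation.TransGen (A I) (Q u) (Q v). -/

import Mathlib

/-- The merge map `q(S,l)`: sends every vertex of `S` to the label `l`, fixes others. -/
noncomputable def mergeMap {V : Type*} (S : Set V) (l : V) (v : V) : V :=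
  open Classical in if v ∈ S then l else v

/-- One GloVE merging step: the merged arc relation `merge(A,S,l)`. -/
def mergeRel {V : Type*} (A : V → V → Prop) (S : Set V) (l : V) (u v : V) : Prop :=
  (u ∉ S ∧ v ∉ S ∧ A u v) ∨
  (u = l ∧ v ∉ S ∧ ∃ a ∈ S, A a v) ∨
  (v = l ∧ u ∉ S ∧ ∃ b ∈ S, A u b)

/-- `S` is independent in `A`: no arc of `A` has both endpoints in `S`. -/
def Independent {V : Type*} (A : V → V → Prop) (S : Set V) : Prop :=
  ∀ a b, A a b → ¬(a ∈ S ∧ b ∈ S)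

/-- Composition `q(S (i-1), l (i-1)) ∘ ⋯ ∘ q(S 0, l 0)` of the merge maps. -/
noncomputable def iterMergeMap {V : Type*} (S : ℕ → Set V) (l : ℕ → V) : ℕ → V → V
  | 0 => id
  | (i + 1) => mergeMap (S i) (l i) ∘ iterMergeMap S l i

/-- Merging an independent set sends arcs to arcs. -/
theorem Independent.mergeRel_mergeMap {V : Type*} {A : V → V → Prop} {S : Set V}
    (hS : Independent A S) (l : V) {u v : V} (h : A u v) :
    mergeRel A S l (mergeMap S l u) (mergeMap S l v) := by
  by_cases hu : u ∈ S <;> by_cases hv : v ∈ S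
  · exact absurd ⟨hu, hv⟩ (hS u v h)
  · simp only [mergeMap, hu, hv, if_true, if_false]
    exact Or.inr (Or.inl ⟨rfl, hv, u, hu, h⟩)
  · simp only [mergeMap, hu, hv, if_true, if_false]
    exact Or.inr (Or.inr ⟨rfl, hu, v, hv, h⟩)
  · simp only [mergeMap, hu, hv, if_false]
    exact Or.inl ⟨hu, hv, h⟩

/-- Directed reachability is preserved by the GloVE summarization. -/
theorem iterMergeMap_preserves_reachability {V : Type*} (I : ℕ)
    (A : ℕ → (V → V → Prop)) (S : ℕ → Set V) (l : ℕ → V)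
    (hl : ∀ i < I, l i ∉ S i)
    (hind : ∀ i < I, Independent (A i) (S i))
    (hstep : ∀ i < I, A (i + 1) = mergeRel (A i) (S i) (l i)) :
    ∀ u v : V, Relation.TransGen (A 0) u v →
      Relation.TransGen (A I) (iterMergeMap S l I u) (iterMergeMap S l I v) := by
  intro u v huv
  induction I with
  | zero => exact huv
  | succ n ih =>
    have h := ih (fun i hi => hl i (by omega)) (fun i hi => hind i (by omega))
      (fun i hi => hstep i (by omega))
    rw [hstep n n.lt_succ_self]
    exact h.lift (mergeMap (S n) (l n))
      fun _ _ hab => (hind n n.lt_succ_self).mergeRel_mergeMap (l n) hab
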